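/- Let (P_t)_{t∈T} be a family of projection-valued measures on a complex Hilbert space H, where P_t is a PVM on (Λ_t, F_t) and each Λ_t is nonempty. Then there exist a set Ω, an algebra F_Ω of subsets of Ω, and for each t ∈ T a function f_t : Ω → Λ_t with f_t⁻¹(B) ∈ F_Ω for every B ∈ F_t, such that: (i) for every state φ on L(H) there is a unique normalized finitely additive real-valued measure μ_φ on F_Ω satisfying (1/n!)·φ({P_{t₁}(B₁)·…·P_{tₙ}(Bₙ)}_sym) = μ_φ(f_{t₁}⁻¹(B₁) ∩ ⋯ ∩ f_{tₙ}⁻¹(Bₙ)) for every finite collection of distinct indices t₁,…,tₙ ∈ T and all Bᵢ ∈ F_{tᵢ}; and (ii) f_{t₁} ≠ f_{t₂} for all t₁ ≠ t₂ for which it is not the case that Λ_{t₁} and Λ_{t₂} are both equal to one and the same singleton set. -/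

import Mathlib

open scoped BigOperators ComplexOrder

universe u v

/-- An algebra of subsets of a set `α` (here: of the sample space `Ω`). -/
structure SetAlgebra (α : Type*) where
  sets : Set (Set α)
  univ_mem : Set.univ ∈ sets
  compl_mem : ∀ ⦃s : Set α⦄, s ∈ sets → sᶜ ∈ sets
  union_mem : ∀ ⦃s t : Set α⦄, s ∈ sets → t ∈ sets → s ∪ t ∈ sets

/-- An algebra of subsets of a set `Λ ⊆ α`: a collection of subsets of `Λ` containing `Λ`
and closed under relative complements and finite unions. -/
structure SetAlgebraOn {α : Type*} (Λ : Set α) where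
  sets : Set (Set α)
  subset_of_mem : ∀ ⦃B : Set α⦄, B ∈ sets → B ⊆ Λ
  top_mem : Λ ∈ sets
  diff_mem : ∀ ⦃B : Set α⦄, B ∈ sets → Λ \ B ∈ sets
  union_mem : ∀ ⦃B C : Set α⦄, B ∈ sets → C ∈ sets → B ∪ C ∈ sets

/-- A projection-valued measure on `(Λ, F)`, `Λ ⊆ α`, with values in the bounded
operators on `H`. -/
structure PVMOn (H : Type*) [NormedAddCommGroup H] [InnerProductSpace ℂ H]
    [CompleteSpace H] {α : Type*} {Λ : Set α} (F : SetAlgebraOn Λ) where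
  toFun : Set α → (H →L[ℂ] H)
  isSelfAdjoint_of_mem : ∀ ⦃B : Set α⦄, B ∈ F.sets → IsSelfAdjoint (toFun B)
  idem_of_mem : ∀ ⦃B : Set α⦄, B ∈ F.sets → toFun B * toFun B = toFun B
  map_top : toFun Λ = 1
  map_empty : toFun ∅ = 0
  map_union : ∀ ⦃B₁ B₂ : Set α⦄, B₁ ∈ F.sets → B₂ ∈ F.sets → Disjoint B₁ B₂ →
    toFun (B₁ ∪ B₂) = toFun B₁ + toFun B₂
  map_inter : ∀ ⦃B₁ B₂ : Set α⦄, B₁ ∈ F.sets → B₂ ∈ F.sets →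
    toFun (B₁ ∩ B₂) = toFun B₁ * toFun B₂

/-- The symmetrized product `{Z₁ ⋯ Zₙ}_sym`: the sum over all permutations `σ` of
the ordered operator products `Z_{σ(1)} ⋯ Z_{σ(n)}`. -/
noncomputable def symProd {H : Type*} [NormedAddCommGroup H] [InnerProductSpace ℂ H]
    [CompleteSpace H] {n : ℕ} (Z : Fin n → (H →L[ℂ] H)) : H →L[ℂ] H :=
  ∑ σ : Equiv.Perm (Fin n), (List.ofFn fun i => Z (σ i)).prod

/-- A state on `L(H)`: a linear functional `φ` with `φ(A* A) ≥ 0` for all `A` and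
`φ(1) = 1`. -/
def IsState {H : Type*} [NormedAddCommGroup H] [InnerProductSpace ℂ H] [CompleteSpace H]
    (φ : (H →L[ℂ] H) →ₗ[ℂ] ℂ) : Prop :=
  φ 1 = 1 ∧ ∀ A : H →L[ℂ] H, 0 ≤ φ (star A * A)


section QCM
variable {H : Type*} [NormedAddCommGroup H] [InnerProductSpace ℂ H] [CompleteSpace H]

lemma qcm_prod_skip {M : Type*} [Monoid M] : ∀ {n : ℕ} (p : Fin (n+1)) (g : Fin (n+1) → M),
    g p = 1 → (List.ofFn g).prod = (List.ofFn (fun i => g (p.succAbove i))).prod := by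
  intro n
  induction n with
  | zero =>
    intro p g h
    have : p = 0 := by ext; omega
    subst this
    simp [h]
  | succ n ih =>
    intro p g h
    induction p using Fin.cases with
    | zero => rw [List.ofFn_succ]; simp [h]
    | succ q =>
      rw [List.ofFn_succ, List.prod_cons, ih q (fun i => g i.succ) h,
        List.ofFn_succ (f := fun i => g (q.succ.succAbove i)), List.prod_cons]
      simp

def qcmPerm {n : ℕ} (x : Fin (n+1) × Equiv.Perm (Fin n)) : Equiv.Perm (Fin (n+1)) :=
  (finSuccEquiv' x.1).trans ((Equiv.optionCongr x.2).trans (finSuccEquiv' 0).symm)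

lemma qcmPerm_at {n : ℕ} (x : Fin (n+1) × Equiv.Perm (Fin n)) : qcmPerm x x.1 = 0 := by
  simp [qcmPerm]

lemma qcmPerm_above {n : ℕ} (x : Fin (n+1) × Equiv.Perm (Fin n)) (i : Fin n) :
    qcmPerm x (x.1.succAbove i) = (x.2 i).succ := by
  simp [qcmPerm]

lemma qcmPerm_bij {n : ℕ} : Function.Bijective (qcmPerm (n := n)) := by
  rw [Fintype.bijective_iff_injective_and_card]
  constructor
  · rintro ⟨p, τ⟩ ⟨q, ρ⟩ h
    have hp : p = q := by
      have h1 := qcmPerm_at (p, τ)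
      have h2 := qcmPerm_at (q, ρ)
      rw [h] at h1
      exact (qcmPerm (q, ρ)).injective (h1.trans h2.symm)
    subst hp
    have : τ = ρ := by
      ext i
      have h1 := qcmPerm_above (p, τ) i
      have h2 := qcmPerm_above (p, ρ) i
      rw [h] at h1
      have := h1.symm.trans h2
      simpa using congrArg Fin.val (Fin.succ_injective _ this)
    rw [this]
  · simp [Fintype.card_perm, Nat.factorial_succ]

lemma qcm_symProd_cons {n : ℕ} (Z : Fin (n+1) → (H →L[ℂ] H)) (h : Z 0 = 1) :
    symProd Z = ((n+1 : ℕ) : ℂ) • symProd (fun i => Z i.succ) := by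
  unfold symProd
  rw [← (Equiv.ofBijective _ (qcmPerm_bij (n := n))).sum_comp, Fintype.sum_prod_type]
  have : ∀ (p : Fin (n+1)) (τ : Equiv.Perm (Fin n)),
      (List.ofFn fun i => Z ((Equiv.ofBijective _ (qcmPerm_bij (n := n))) (p, τ) i)).prod
        = (List.ofFn fun i => Z (τ i).succ).prod := by
    intro p τ
    rw [qcm_prod_skip p]
    · congr 2
      ext1 i
      exact congrArg Z (qcmPerm_above (p, τ) i)
    · simp only [Equiv.ofBijective_apply]
      rw [qcmPerm_at (p, τ), h]
  simp only [this]
  simp [← Nat.cast_smul_eq_nsmul ℂ]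

lemma qcm_symProd_perm {n : ℕ} (Z : Fin n → (H →L[ℂ] H)) (e : Equiv.Perm (Fin n)) :
    symProd (fun i => Z (e i)) = symProd Z := by
  unfold symProd
  exact Fintype.sum_equiv (Equiv.mulLeft e) _ _ (fun σ => rfl)

lemma qcm_symProd_star {n : ℕ} (Z : Fin n → (H →L[ℂ] H)) (h : ∀ i, IsSelfAdjoint (Z i)) :
    IsSelfAdjoint (symProd Z) := by
  unfold symProd IsSelfAdjoint
  rw [star_sum]
  refine Fintype.sum_equiv (Equiv.mulRight (Fin.revPerm : Equiv.Perm (Fin n))) _ _ fun σ => ?_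
  have key : ∀ l : List (H →L[ℂ] H), (∀ x ∈ l, IsSelfAdjoint x) → star l.prod = l.reverse.prod := by
    intro l
    induction l with
    | nil => intro _; simp
    | cons a l ih =>
      intro hl
      simp only [List.prod_cons, star_mul, List.reverse_cons, List.prod_append, List.prod_nil,
        mul_one]
      rw [ih (fun x hx => hl x (by simp [hx])), (hl a (by simp)).star_eq]
  rw [key]
  · congr 1
    apply List.ext_getElem
    · simp
    · intro i h1 h2
      simp [Fin.rev]
      congr 2
      ext
      simp at h1 h2 ⊢
      omega
  · intro x hx
    rw [List.mem_ofFn] at hx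
    obtain ⟨i, rfl⟩ := hx
    exact h _

lemma qcm_state_real {φ : (H →L[ℂ] H) →ₗ[ℂ] ℂ} (hφ : IsState φ) (A : H →L[ℂ] H)
    (hA : IsSelfAdjoint A) : (φ A).im = 0 := by
  have h1 := (Complex.le_def.1 (hφ.2 (1 + A))).2
  have h2 := (Complex.le_def.1 (hφ.2 A)).2
  have h3 : star (1 + A) * (1 + A) = 1 + (A + A) + star A * A := by
    rw [star_add, star_one, hA.star_eq]; noncomm_ring
  rw [h3, map_add, map_add, map_add, hφ.1] at h1
  simp at h1 h2
  linarith

noncomputable def qcmAvg {n : ℕ} (Z : Fin n → (H →L[ℂ] H)) : H →L[ℂ] H :=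
  (n.factorial : ℂ)⁻¹ • symProd Z

lemma qcmAvg_cons {n : ℕ} (Z : Fin (n+1) → (H →L[ℂ] H)) (h : Z 0 = 1) :
    qcmAvg Z = qcmAvg (fun i => Z i.succ) := by
  unfold qcmAvg
  rw [qcm_symProd_cons Z h, smul_smul]
  congr 1
  rw [Nat.factorial_succ]
  have : ((n + 1 : ℕ) : ℂ) ≠ 0 := by exact_mod_cast Nat.succ_ne_zero n
  have : (n.factorial : ℂ) ≠ 0 := by exact_mod_cast Nat.factorial_ne_zero n
  push_cast at *
  field_simp

lemma qcmAvg_congr {T : Type*} {n m : ℕ} (t : Fin n → T) (t' : Fin m → T)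
    (ht : Function.Injective t) (ht' : Function.Injective t') (hr : Set.range t = Set.range t')
    (Z : T → (H →L[ℂ] H)) : qcmAvg (fun i => Z (t i)) = qcmAvg (fun i => Z (t' i)) := by
  let e : Fin n ≃ Fin m := (Equiv.ofInjective t ht).trans
    ((Equiv.setCongr hr).trans (Equiv.ofInjective t' ht').symm)
  have he : ∀ i, t' (e i) = t i := by
    intro i
    have := Equiv.apply_ofInjective_symm ht' ((Equiv.setCongr hr) (Equiv.ofInjective t ht i))
    simpa [e] using this
  have hnm : n = m := by simpa using Fintype.card_congr e
  subst hnm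
  unfold qcmAvg
  rw [← qcm_symProd_perm (fun i => Z (t' i)) e]
  simp only [he]

noncomputable def qcmS {T : Type*} (s : Finset T) (Z : T → (H →L[ℂ] H)) : H →L[ℂ] H :=
  qcmAvg (fun i => Z (s.equivFin.symm i))

lemma qcmS_eq {T : Type*} (s : Finset T) {n : ℕ} (t : Fin n → T) (ht : Function.Injective t)
    (hr : Set.range t = s) (Z : T → (H →L[ℂ] H)) : qcmAvg (fun i => Z (t i)) = qcmS s Z := by
  refine qcmAvg_congr t (fun i => (s.equivFin.symm i : T)) ht
    (Subtype.val_injective.comp s.equivFin.symm.injective) ?_ Z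
  rw [hr]
  ext x
  constructor
  · intro hx
    exact ⟨s.equivFin ⟨x, hx⟩, by simp⟩
  · rintro ⟨i, rfl⟩
    exact (s.equivFin.symm i).2

lemma qcmS_insert {T : Type*} [DecidableEq T] (s : Finset T) (k : T) (hk : k ∉ s)
    (Z : T → (H →L[ℂ] H)) (hZ : Z k = 1) : qcmS (insert k s) Z = qcmS s Z := by
  rw [← qcmS_eq (insert k s) (Fin.cons k (fun i => (s.equivFin.symm i : T)) : Fin (s.card+1) → T)]
  · rw [qcmAvg_cons _ (by simpa using hZ)]
    simp [qcmS]
  · rw [Fin.cons_injective_iff]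
    refine ⟨?_, Subtype.val_injective.comp s.equivFin.symm.injective⟩
    rintro ⟨i, rfl⟩
    exact hk (s.equivFin.symm i).2
  · rw [Fin.range_cons]
    ext x
    simp only [Set.mem_insert_iff, Set.mem_range, Finset.coe_insert, Finset.mem_coe]
    refine or_congr_right ⟨?_, fun hx => ⟨s.equivFin ⟨x, hx⟩, by simp⟩⟩
    rintro ⟨i, rfl⟩
    exact (s.equivFin.symm i).2

lemma qcmS_mono {T : Type*} (s s' : Finset T) (hs : s ⊆ s')
    (Z : T → (H →L[ℂ] H)) (hZ : ∀ k ∈ s', k ∉ s → Z k = 1) : qcmS s' Z = qcmS s Z := by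
  classical
  obtain ⟨d, hd, rfl⟩ : ∃ d, Disjoint d s ∧ s' = d ∪ s :=
    ⟨s' \ s, Finset.sdiff_disjoint, by rw [Finset.sdiff_union_of_subset hs]⟩
  clear hs
  induction d using Finset.induction_on with
  | empty => simp
  | insert k d hk ih =>
    rw [Finset.disjoint_insert_left] at hd
    rw [Finset.insert_union, qcmS_insert, ih hd.2]
    · intro j hj hjs
      exact hZ j (by simp at hj ⊢; tauto) hjs
    · simp [hk, hd.1]
    · exact hZ k (by simp) hd.1

lemma qcmS_congr {T : Type*} (s : Finset T) (Z Z' : T → (H →L[ℂ] H)) (h : ∀ k ∈ s, Z k = Z' k) :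
    qcmS s Z = qcmS s Z' := by
  unfold qcmS
  congr 1
  ext1 i
  exact h _ (s.equivFin.symm i).2

lemma qcmS_empty {T : Type*} (Z : T → (H →L[ℂ] H)) : qcmS ∅ Z = 1 := by
  rw [← qcmS_eq ∅ (Fin.elim0 : Fin 0 → T) (fun i => i.elim0) (by simp)]
  simp [qcmAvg, symProd]

lemma qcmS_star {T : Type*} (s : Finset T) (Z : T → (H →L[ℂ] H)) (h : ∀ t ∈ s, IsSelfAdjoint (Z t)) :
    IsSelfAdjoint (qcmS s Z) := by
  unfold qcmS qcmAvg
  refine IsSelfAdjoint.smul ?_ (qcm_symProd_star _ fun i => h _ (s.equivFin.symm i).2)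
  simp [IsSelfAdjoint]

/-- the multilinear version -/
noncomputable def qcmM {T : Type*} (s : Finset T) :
    MultilinearMap ℂ (fun _ : s => (H →L[ℂ] H)) (H →L[ℂ] H) :=
  (s.card.factorial : ℂ)⁻¹ • ∑ σ : Equiv.Perm (Fin s.card),
    (MultilinearMap.mkPiAlgebraFin ℂ s.card (H →L[ℂ] H)).domDomCongr (σ.trans s.equivFin.symm)

lemma qcmM_apply {T : Type*} (s : Finset T) (Z : T → (H →L[ℂ] H)) :
    qcmM s (fun i => Z i) = qcmS s Z := by
  simp [qcmM, qcmS, qcmAvg, symProd]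

/-- algebra facts -/
lemma qcm_inter_mem {α : Type*} {L : Set α} (F : SetAlgebraOn L) {B C : Set α}
    (hB : B ∈ F.sets) (hC : C ∈ F.sets) : B ∩ C ∈ F.sets := by
  have := F.diff_mem (F.union_mem (F.diff_mem hB) (F.diff_mem hC))
  convert this using 1
  have h1 := F.subset_of_mem hB
  ext x
  have := @h1 x
  simp only [Set.mem_inter_iff, Set.mem_sdiff, Set.mem_union]
  tauto

lemma qcm_empty_mem {α : Type*} {L : Set α} (F : SetAlgebraOn L) : ∅ ∈ F.sets := by
  simpa using F.diff_mem F.top_mem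

lemma qcm_atom_mem {α ι : Type*} {L : Set α} (F : SetAlgebraOn L) (J : Finset ι)
    (b : ι → Set α) (p : ι → Prop) (hb : ∀ j ∈ J, b j ∈ F.sets) :
    {x | x ∈ L ∧ ∀ j ∈ J, (x ∈ b j ↔ p j)} ∈ F.sets := by
  classical
  induction J using Finset.induction_on with
  | empty => simpa using F.top_mem
  | insert k J hk ih =>
    have h1 := ih fun j hj => hb j (by simp [hj])
    have hk' := hb k (by simp)
    by_cases hp : p k
    · convert qcm_inter_mem F hk' h1 using 1
      ext x; simp [hp]; try tauto
    · convert qcm_inter_mem F (F.diff_mem hk') h1 using 1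
      ext x; simp [hp]; try tauto

lemma qcm_pvm_sum {α ι : Type*} {L : Set α} {F : SetAlgebraOn L} (P : PVMOn H F) (K : Finset ι)
    (a : ι → Set α) (ha : ∀ i ∈ K, a i ∈ F.sets)
    (hd : ∀ i ∈ K, ∀ j ∈ K, i ≠ j → Disjoint (a i) (a j)) :
    (⋃ i ∈ K, a i) ∈ F.sets ∧ P.toFun (⋃ i ∈ K, a i) = ∑ i ∈ K, P.toFun (a i) := by
  classical
  induction K using Finset.induction_on with
  | empty => simp [P.map_empty, qcm_empty_mem]
  | insert k K hk ih =>
    obtain ⟨h1, h2⟩ := ih (fun i hi => ha i (by simp [hi]))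
      (fun i hi j hj => hd i (by simp [hi]) j (by simp [hj]))
    have hk' := ha k (by simp)
    rw [Finset.set_biUnion_insert, Finset.sum_insert hk, ← h2]
    refine ⟨F.union_mem hk' h1, P.map_union hk' h1 ?_⟩
    rw [Set.disjoint_iUnion₂_right]
    intro j hj
    exact hd k (by simp) j (by simp [hj]) (by rintro rfl; exact hk hj)

open Classical in
lemma qcm_discrete {α : Type*} {L : Set α} (hL : L.Nonempty) {F : SetAlgebraOn L} (P : PVMOn H F)
    (J : Finset (Set α)) (hJ : ∀ B ∈ J, B ∈ F.sets) :
    ∃ (rep : Finset (Set α) → L) (Q : Finset (Set α) → (H →L[ℂ] H)), ∀ B ∈ J,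
      P.toFun B = ∑ σ ∈ J.powerset, (if (rep σ : α) ∈ B then (1 : ℂ) else 0) • Q σ := by
  let a : Finset (Set α) → Set α := fun σ => {x | x ∈ L ∧ ∀ j ∈ J, (x ∈ j ↔ j ∈ σ)}
  have ha : ∀ σ, a σ ∈ F.sets := fun σ => qcm_atom_mem F J id (· ∈ σ) hJ
  have hrep : ∀ σ, ∃ x : L, (a σ).Nonempty → (x : α) ∈ a σ := by
    intro σ
    by_cases h : (a σ).Nonempty
    · obtain ⟨x, hx⟩ := h
      exact ⟨⟨x, hx.1⟩, fun _ => hx⟩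
    · obtain ⟨x, hx⟩ := hL
      exact ⟨⟨x, hx⟩, fun h' => absurd h' h⟩
  choose rep hrep using hrep
  refine ⟨rep, fun σ => P.toFun (a σ), ?_⟩
  intro B hB
  have hd : ∀ i ∈ J.powerset.filter (B ∈ ·), ∀ j ∈ J.powerset.filter (B ∈ ·), i ≠ j →
      Disjoint (a i) (a j) := by
    intro i hi j hj hij
    rw [Set.disjoint_left]
    intro x hx hx'
    apply hij
    simp only [Finset.mem_filter, Finset.mem_powerset] at hi hj
    ext C
    constructor
    · intro hC
      exact (hx'.2 C (hi.1 hC)).1 ((hx.2 C (hi.1 hC)).2 hC)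
    · intro hC
      exact (hx.2 C (hj.1 hC)).1 ((hx'.2 C (hj.1 hC)).2 hC)
  have h1 := (qcm_pvm_sum P (J.powerset.filter (B ∈ ·)) a (fun i _ => ha i) hd).2
  have h2 : (⋃ i ∈ J.powerset.filter (B ∈ ·), a i) = B := by
    ext x
    simp only [Set.mem_iUnion, Finset.mem_filter, Finset.mem_powerset, exists_prop]
    constructor
    · rintro ⟨σ, ⟨_, hσ⟩, hx⟩
      exact (hx.2 B hB).2 hσ
    · intro hx
      exact ⟨J.filter (x ∈ ·), ⟨Finset.filter_subset _ _, by simp [hB, hx]⟩,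
        F.subset_of_mem (hJ B hB) hx, fun j hj => by simp [hj]⟩
  rw [h2, Finset.sum_filter] at h1
  rw [h1]
  refine Finset.sum_congr rfl fun σ hσ => ?_
  by_cases hne : (a σ).Nonempty
  · have h3 := (hrep σ hne).2 B hB
    simp only [h3]
    split_ifs <;> simp
  · rw [Set.not_nonempty_iff_eq_empty] at hne
    have h4 : P.toFun (a σ) = 0 := by rw [hne, P.map_empty]
    simp [h4]

end QCM

section QCM2
variable {H : Type*} [NormedAddCommGroup H] [InnerProductSpace ℂ H] [CompleteSpace H]
variable {α : Type*} {T : Type*}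

/-- cylinders -/
def qcmCyl (Λ : T → Set α) (s : Finset T) (B : T → Set α) : Set (∀ t, Λ t) :=
  {ω | ∀ t ∈ s, (ω t : α) ∈ B t}

open Classical in
lemma qcm_mG {Λ : T → Set α} (hΛ : ∀ t, (Λ t).Nonempty)
    {F : ∀ t, SetAlgebraOn (Λ t)} (P : ∀ t, PVMOn H (F t)) (φ : (H →L[ℂ] H) →ₗ[ℂ] ℂ)
    (G : Finset {g : T × Set α // g.2 ∈ (F g.1).sets}) :
    ∃ m : Set (∀ t, Λ t) → ℂ, (∀ A B, Disjoint A B → m (A ∪ B) = m A + m B) ∧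
      ∀ (s : Finset T) (B : T → Set α) (hB : ∀ t, B t ∈ (F t).sets),
        (∀ t ∈ s, (⟨(t, B t), hB t⟩ : {g : T × Set α // g.2 ∈ (F g.1).sets}) ∈ G) →
        m (qcmCyl Λ s B) = φ (qcmS s (fun t => (P t).toFun (B t))) := by
  let J : T → Finset (Set α) := fun t =>
    insert (Λ t) ((G.filter (fun g => g.1.1 = t)).image (fun g => g.1.2))
  have hJ : ∀ t, ∀ B ∈ J t, B ∈ (F t).sets := by
    intro t B hB
    simp only [J, Finset.mem_insert, Finset.mem_image, Finset.mem_filter] at hB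
    rcases hB with rfl | ⟨g, ⟨_, rfl⟩, rfl⟩
    · exact (F t).top_mem
    · exact g.2
  choose rep Q hQ using fun t => qcm_discrete (hΛ t) (P t) (J t) (hJ t)
  let S : Finset T := G.image (fun g => g.1.1)
  let pt : (S → Finset (Set α)) → ∀ t, Λ t := fun r t =>
    if h : t ∈ S then rep t (r ⟨t, h⟩) else ⟨(hΛ t).choose, (hΛ t).choose_spec⟩
  refine ⟨fun A => ∑ r ∈ Fintype.piFinset (fun i : S => (J i).powerset),
    (if pt r ∈ A then (1 : ℂ) else 0) * φ (qcmM S (fun i => Q i (r i))), ?_, ?_⟩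
  · intro A B hAB
    rw [← Finset.sum_add_distrib]
    refine Finset.sum_congr rfl fun r _ => ?_
    rw [← add_mul]
    congr 1
    have : pt r ∈ A → pt r ∉ B := fun h => Set.disjoint_left.1 hAB h
    by_cases h1 : pt r ∈ A
    · simp [h1, this h1]
    · simp [h1]
  · intro s B hB hs
    have hsS : s ⊆ S := fun t ht => Finset.mem_image.2 ⟨_, hs t ht, rfl⟩
    let B' : T → Set α := fun t => if t ∈ s then B t else Λ t
    have hB' : ∀ t, B' t ∈ J t := by
      intro t
      by_cases h : t ∈ s
      · simp only [B', h, if_true, J, Finset.mem_insert, Finset.mem_image, Finset.mem_filter]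
        exact Or.inr ⟨_, ⟨hs t h, rfl⟩, rfl⟩
      · simp [B', h, J]
    have e1 : qcmS s (fun t => (P t).toFun (B t)) = qcmS S (fun t => (P t).toFun (B' t)) := by
      rw [qcmS_mono s S hsS]
      · exact qcmS_congr _ _ _ fun k hk => by simp [B', hk]
      · intro k _ hk
        simp [B', hk, (P k).map_top]
    rw [e1, ← qcmM_apply]
    have e2 : (fun i : S => (P i).toFun (B' i)) = fun i : S =>
        ∑ σ ∈ (J i).powerset, (if (rep i σ : α) ∈ B' i then (1 : ℂ) else 0) • Q i σ :=
      funext fun i => hQ i _ (hB' i)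
    rw [e2, MultilinearMap.map_sum_finset, map_sum]
    refine Finset.sum_congr rfl fun r _ => ?_
    rw [MultilinearMap.map_smul_univ, map_smul, smul_eq_mul]
    congr 1
    rw [Finset.prod_ite_zero]
    simp only [Finset.prod_const_one]
    congr 1
    apply propext
    constructor
    · intro h i _
      by_cases hi : (i : T) ∈ s
      · have := h i hi
        simpa [pt, B', hi] using this
      · simp [B', hi]
    · intro h t ht
      have := h ⟨t, hsS ht⟩ (Finset.mem_univ _)
      simpa [pt, B', ht, hsS ht] using this

/-- the algebra on the product -/
def qcmAlg {Λ : T → Set α} (F : ∀ t, SetAlgebraOn (Λ t)) : SetAlgebra (∀ t, Λ t) where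
  sets := {A | ∃ G : Finset {g : T × Set α // g.2 ∈ (F g.1).sets}, ∀ ω ω' : ∀ t, Λ t,
    (∀ g ∈ G, ((ω g.1.1 : α) ∈ g.1.2 ↔ (ω' g.1.1 : α) ∈ g.1.2)) → (ω ∈ A ↔ ω' ∈ A)}
  univ_mem := ⟨∅, by simp⟩
  compl_mem := by
    rintro A ⟨G, h⟩
    exact ⟨G, fun ω ω' hω => not_congr (h ω ω' hω)⟩
  union_mem := by
    classical
    rintro A B ⟨G, h⟩ ⟨G', h'⟩
    exact ⟨G ∪ G', fun ω ω' hω => or_congr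
      (h ω ω' fun g hg => hω g (by simp [hg])) (h' ω ω' fun g hg => hω g (by simp [hg]))⟩

lemma qcmCyl_mem {Λ : T → Set α} (F : ∀ t, SetAlgebraOn (Λ t)) (s : Finset T) (B : T → Set α)
    (hB : ∀ t, B t ∈ (F t).sets) : qcmCyl Λ s B ∈ (qcmAlg F).sets := by
  classical
  refine ⟨s.image (fun t => ⟨(t, B t), hB t⟩), fun ω ω' h => ?_⟩
  refine forall₂_congr fun t ht => ?_
  exact h ⟨(t, B t), hB t⟩ (Finset.mem_image_of_mem _ ht)

lemma qcm_add_sum {Ω M ι : Type*} [AddCommGroup M] (Fa : SetAlgebra Ω) (m : Set Ω → M)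
    (hm : ∀ ⦃A B : Set Ω⦄, A ∈ Fa.sets → B ∈ Fa.sets → Disjoint A B → m (A ∪ B) = m A + m B)
    (K : Finset ι) (a : ι → Set Ω) (ha : ∀ i ∈ K, a i ∈ Fa.sets)
    (hd : ∀ i ∈ K, ∀ j ∈ K, i ≠ j → Disjoint (a i) (a j)) :
    (⋃ i ∈ K, a i) ∈ Fa.sets ∧ m (⋃ i ∈ K, a i) = ∑ i ∈ K, m (a i) := by
  classical
  have h0 : ∅ ∈ Fa.sets := by simpa using Fa.compl_mem Fa.univ_mem
  induction K using Finset.induction_on with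
  | empty =>
    have := hm h0 h0 (by simp)
    simp at this
    simp [h0, this]
  | insert k K hk ih =>
    obtain ⟨h1, h2⟩ := ih (fun i hi => ha i (by simp [hi]))
      (fun i hi j hj => hd i (by simp [hi]) j (by simp [hj]))
    have hk' := ha k (by simp)
    rw [Finset.set_biUnion_insert, Finset.sum_insert hk, ← h2]
    refine ⟨Fa.union_mem hk' h1, hm hk' h1 ?_⟩
    rw [Set.disjoint_iUnion₂_right]
    intro j hj
    exact hd k (by simp) j (by simp [hj]) (by rintro rfl; exact hk hj)

lemma qcm_decomp {Λ : T → Set α} (F : ∀ t, SetAlgebraOn (Λ t)) (A : Set (∀ t, Λ t))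
    (hA : A ∈ (qcmAlg F).sets) :
    ∃ (s : Finset T) (K : Finset (Finset {g : T × Set α // g.2 ∈ (F g.1).sets}))
      (B : Finset {g : T × Set α // g.2 ∈ (F g.1).sets} → T → Set α),
      (∀ σ t, B σ t ∈ (F t).sets) ∧
      (∀ i ∈ K, ∀ j ∈ K, i ≠ j → Disjoint (qcmCyl Λ s (B i)) (qcmCyl Λ s (B j))) ∧
      A = ⋃ i ∈ K, qcmCyl Λ s (B i) := by
  classical
  obtain ⟨G, hG⟩ := hA
  let s : Finset T := G.image (fun g => g.1.1)
  let B : Finset {g : T × Set α // g.2 ∈ (F g.1).sets} → T → Set α := fun σ t =>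
    {x | x ∈ Λ t ∧ ∀ g ∈ G.filter (fun g => g.1.1 = t), (x ∈ g.1.2 ↔ g ∈ σ)}
  have hcyl : ∀ σ (ω : ∀ t, Λ t), ω ∈ qcmCyl Λ s (B σ) ↔
      ∀ g ∈ G, ((ω g.1.1 : α) ∈ g.1.2 ↔ g ∈ σ) := by
    intro σ ω
    constructor
    · intro h g hg
      exact (h g.1.1 (Finset.mem_image_of_mem _ hg)).2 g (by simp [hg])
    · intro h t ht
      refine ⟨(ω t).2, fun g hg => ?_⟩
      obtain ⟨hg', rfl⟩ := Finset.mem_filter.1 hg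
      exact h g hg'
  refine ⟨s, G.powerset.filter (fun σ => (qcmCyl Λ s (B σ) ∩ A).Nonempty), B, ?_, ?_, ?_⟩
  · intro σ t
    refine qcm_atom_mem (F t) (G.filter (fun g => g.1.1 = t)) (fun g => g.1.2) (· ∈ σ) ?_
    intro g hg
    obtain ⟨hg, rfl⟩ := Finset.mem_filter.1 hg
    exact g.2
  · intro i hi j hj hij
    rw [Set.disjoint_left]
    intro ω h1 h2
    rw [hcyl] at h1 h2
    apply hij
    simp only [Finset.mem_filter, Finset.mem_powerset] at hi hj
    ext g
    constructor
    · intro hg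
      exact (h2 g (hi.1 hg)).1 ((h1 g (hi.1 hg)).2 hg)
    · intro hg
      exact (h1 g (hj.1 hg)).1 ((h2 g (hj.1 hg)).2 hg)
  · ext ω
    simp only [Set.mem_iUnion, Finset.mem_filter, Finset.mem_powerset, exists_prop]
    constructor
    · intro hω
      have : ω ∈ qcmCyl Λ s (B (G.filter (fun g => (ω g.1.1 : α) ∈ g.1.2))) := by
        rw [hcyl]
        intro g hg
        simp only [Finset.mem_filter, hg, true_and]
      exact ⟨G.filter (fun g => (ω g.1.1 : α) ∈ g.1.2), ⟨Finset.filter_subset _ _, ω, this, hω⟩, this⟩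
    · rintro ⟨σ, ⟨_, ω', h1, h2⟩, h3⟩
      rw [hcyl] at h1 h3
      exact (hG ω ω' fun g hg => (h3 g hg).trans (h1 g hg).symm).2 h2

lemma qcm_exists {Λ : T → Set α} (hΛ : ∀ t, (Λ t).Nonempty)
    {F : ∀ t, SetAlgebraOn (Λ t)} (P : ∀ t, PVMOn H (F t)) (φ : (H →L[ℂ] H) →ₗ[ℂ] ℂ) :
    ∃ m : Set (∀ t, Λ t) → ℂ,
      (∀ ⦃A B⦄, A ∈ (qcmAlg F).sets → B ∈ (qcmAlg F).sets → Disjoint A B → m (A ∪ B) = m A + m B) ∧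
      ∀ (s : Finset T) (B : T → Set α), (∀ t, B t ∈ (F t).sets) →
        m (qcmCyl Λ s B) = φ (qcmS s (fun t => (P t).toFun (B t))) := by
  classical
  choose mG hadd hcyl using qcm_mG hΛ P φ
  have hc : ∀ (s : Finset T) (B : T → Set α), (∀ t, B t ∈ (F t).sets) →
      ∀ᶠ G in Filter.atTop, mG G (qcmCyl Λ s B) = φ (qcmS s (fun t => (P t).toFun (B t))) := by
    intro s B hB
    filter_upwards [Filter.eventually_ge_atTop (s.image (fun t =>
      (⟨(t, B t), hB t⟩ : {g : T × Set α // g.2 ∈ (F g.1).sets})))] with G hG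
    exact hcyl G s B hB fun t ht => hG (Finset.mem_image_of_mem _ ht)
  have hev : ∀ A, ∃ c : ℂ, A ∈ (qcmAlg F).sets → ∀ᶠ G in Filter.atTop, mG G A = c := by
    intro A
    by_cases hA : A ∈ (qcmAlg F).sets
    · obtain ⟨s, K, B, h1, h2, h3⟩ := qcm_decomp F A hA
      refine ⟨∑ i ∈ K, φ (qcmS s (fun t => (P t).toFun (B i t))), fun _ => ?_⟩
      have : ∀ᶠ G in Filter.atTop, ∀ i ∈ K,
          mG G (qcmCyl Λ s (B i)) = φ (qcmS s (fun t => (P t).toFun (B i t))) := by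
        rw [Filter.eventually_all_finset]
        exact fun i _ => hc s (B i) (h1 i)
      filter_upwards [this] with G hG
      rw [h3, (qcm_add_sum (qcmAlg F) (mG G) (fun A B _ _ h => hadd G A B h) K _
        (fun i _ => qcmCyl_mem F s (B i) (h1 i)) h2).2]
      exact Finset.sum_congr rfl hG
    · exact ⟨0, fun h => absurd h hA⟩
  choose m hm using hev
  refine ⟨m, ?_, ?_⟩
  · intro A B hA hB hAB
    obtain ⟨G, h1, h2, h3⟩ := ((hm A hA).and ((hm B hB).and
      (hm _ ((qcmAlg F).union_mem hA hB)))).exists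
    rw [← h1, ← h2, ← h3, hadd G A B hAB]
  · intro s B hB
    obtain ⟨G, h1, h2⟩ := ((hm _ (qcmCyl_mem F s B hB)).and (hc s B hB)).exists
    rw [← h1, h2]

end QCM2

/-- **Theorem 2 of the paper.** For a family `(P_t)_{t∈T}` of PVMs on
nonempty sets `Λ_t ⊆ α` there exist a set `Ω`, an algebra `F_Ω` of its subsets, and
random variables `f_t : Ω → Λ_t` (with preimages of measurable sets in `F_Ω`) such that:
(i) for every state `φ` on `L(H)` there is a unique normalized finitely additive
real-valued measure `μ_φ` on `F_Ω` with
`(1/n!)·φ({P_{t₁}(B₁)⋯P_{tₙ}(Bₙ)}_sym) = μ_φ(f_{t₁}⁻¹(B₁) ∩ ⋯ ∩ f_{tₙ}⁻¹(Bₙ))`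
for all finite collections of distinct indices and `Bᵢ ∈ F_{tᵢ}`; and
(ii) `f_{t₁} ≠ f_{t₂}` whenever `t₁ ≠ t₂`, unless `Λ_{t₁}` and `Λ_{t₂}` are both equal
to one and the same singleton set. -/
theorem exists_quasi_classical_model
    {α : Type u} {T : Type v} [Nonempty T]
    {H : Type*} [NormedAddCommGroup H] [InnerProductSpace ℂ H] [CompleteSpace H]
    (Λ : T → Set α) (hΛ : ∀ t, (Λ t).Nonempty)
    (F : ∀ t, SetAlgebraOn (Λ t)) (P : ∀ t, PVMOn H (F t)) :
    ∃ (Ω : Type (max u v)) (FΩ : SetAlgebra Ω) (f : ∀ t : T, Ω → α),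
      (∀ (t : T) (ω : Ω), f t ω ∈ Λ t) ∧
      (∀ t : T, ∀ B ∈ (F t).sets, f t ⁻¹' B ∈ FΩ.sets) ∧
      (∀ φ : (H →L[ℂ] H) →ₗ[ℂ] ℂ, IsState φ →
        ∃ μ : Set Ω → ℝ,
          (μ Set.univ = 1 ∧
            (∀ ⦃A B : Set Ω⦄, A ∈ FΩ.sets → B ∈ FΩ.sets → Disjoint A B →
              μ (A ∪ B) = μ A + μ B) ∧
            (∀ (n : ℕ) (t : Fin n → T), Function.Injective t →
              ∀ (B : ∀ i : Fin n, Set α), (∀ i, B i ∈ (F (t i)).sets) →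
                (n.factorial : ℂ)⁻¹ * φ (symProd (fun i => (P (t i)).toFun (B i))) =
                  (μ (⋂ i : Fin n, f (t i) ⁻¹' B i) : ℂ))) ∧
          (∀ μ' : Set Ω → ℝ,
            (μ' Set.univ = 1 ∧
              (∀ ⦃A B : Set Ω⦄, A ∈ FΩ.sets → B ∈ FΩ.sets → Disjoint A B →
                μ' (A ∪ B) = μ' A + μ' B) ∧
              (∀ (n : ℕ) (t : Fin n → T), Function.Injective t →
                ∀ (B : ∀ i : Fin n, Set α), (∀ i, B i ∈ (F (t i)).sets) →
                  (n.factorial : ℂ)⁻¹ * φ (symProd (fun i => (P (t i)).toFun (B i))) =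
                    (μ' (⋂ i : Fin n, f (t i) ⁻¹' B i) : ℂ))) →
            ∀ A ∈ FΩ.sets, μ' A = μ A)) ∧
      (∀ t₁ t₂ : T, t₁ ≠ t₂ → (¬ ∃ a : α, Λ t₁ = {a} ∧ Λ t₂ = {a}) → f t₁ ≠ f t₂) := by
  classical
  have hcylt : ∀ (n : ℕ) (t : Fin n → T), Function.Injective t →
      ∀ (B : Fin n → Set α), (∀ i, B i ∈ (F (t i)).sets) →
      ∃ (s : Finset T) (B' : T → Set α), (∀ t, B' t ∈ (F t).sets) ∧
        (⋂ i : Fin n, (fun ω : ∀ t, Λ t => (ω (t i) : α)) ⁻¹' B i) = qcmCyl Λ s B' ∧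
        ∀ φ : (H →L[ℂ] H) →ₗ[ℂ] ℂ,
          (n.factorial : ℂ)⁻¹ * φ (symProd (fun i => (P (t i)).toFun (B i))) =
            φ (qcmS s (fun t => (P t).toFun (B' t))) := by
    intro n t ht B hB
    let B' : T → Set α := Function.extend t B Λ
    have hB' : ∀ i, B' (t i) = B i := fun i => ht.extend_apply B Λ i
    refine ⟨Finset.univ.image t, B', ?_, ?_, ?_⟩
    · intro x
      by_cases hx : ∃ i, t i = x
      · obtain ⟨i, rfl⟩ := hx
        rw [hB']
        exact hB i
      · have : B' x = Λ x := Function.extend_apply' _ _ _ hx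
        rw [this]
        exact (F x).top_mem
    · ext ω
      simp [qcmCyl, hB']
    · intro φ
      rw [← qcmS_eq (Finset.univ.image t) t ht (by simp)]
      simp only [hB', qcmAvg, map_smul, smul_eq_mul]
  -- conversely, cylinders come from enumerations
  have hcylt' : ∀ (s : Finset T) (B : T → Set α),
      ∃ t : Fin s.card → T, Function.Injective t ∧
        (⋂ i, (fun ω : ∀ t, Λ t => (ω (t i) : α)) ⁻¹' B (t i)) = qcmCyl Λ s B := by
    intro s B
    refine ⟨fun i => s.equivFin.symm i,
      Subtype.val_injective.comp s.equivFin.symm.injective, ?_⟩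
    ext ω
    simp only [Set.mem_iInter, Set.mem_preimage, qcmCyl, Set.mem_ofPred_eq]
    constructor
    · intro h t ht
      have := h (s.equivFin ⟨t, ht⟩)
      rw [Equiv.symm_apply_apply] at this
      exact this
    · intro h i
      exact h _ (s.equivFin.symm i).2
  refine ⟨∀ t, Λ t, qcmAlg F, fun t ω => ω t, fun t ω => (ω t).2, ?_, ?_, ?_⟩
  · intro t B hB
    refine ⟨{⟨(t, B), hB⟩}, fun ω ω' h => ?_⟩
    exact h ⟨(t, B), hB⟩ (Finset.mem_singleton_self _)
  · intro φ hφ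
    obtain ⟨m, hadd, hcyl⟩ := qcm_exists hΛ P φ
    have hprop : ∀ (n : ℕ) (t : Fin n → T), Function.Injective t →
        ∀ (B : ∀ i : Fin n, Set α), (∀ i, B i ∈ (F (t i)).sets) →
          (n.factorial : ℂ)⁻¹ * φ (symProd (fun i => (P (t i)).toFun (B i))) =
          (((m (⋂ i : Fin n, (fun ω : ∀ t, Λ t => (ω (t i) : α)) ⁻¹' B i)).re : ℝ) : ℂ) := by
      intro n t ht B hB
      obtain ⟨s, B', h1, h2, h3⟩ := hcylt n t ht B hB
      rw [h2, h3, hcyl s B' h1]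
      apply Complex.ext
      · simp
      · rw [qcm_state_real hφ _ (qcmS_star s _ fun t _ => (P t).isSelfAdjoint_of_mem (h1 t))]
        simp
    refine ⟨fun A => (m A).re, ⟨?_, ?_, hprop⟩, ?_⟩
    · have h1 := hcyl ∅ Λ (fun t => (F t).top_mem)
      rw [qcmS_empty, hφ.1] at h1
      have h2 : qcmCyl Λ ∅ Λ = Set.univ := by ext; simp [qcmCyl]
      rw [h2] at h1
      simp [h1]
    · intro A B hA hB hAB
      simp [hadd hA hB hAB]
    · rintro μ' ⟨-, hadd', hprop'⟩ A hA
      obtain ⟨s, K, B, h1, h2, h3⟩ := qcm_decomp F A hA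
      have hmem : ∀ i ∈ K, qcmCyl Λ s (B i) ∈ (qcmAlg F).sets :=
        fun i _ => qcmCyl_mem F s (B i) (h1 i)
      change μ' A = (m A).re
      rw [h3, (qcm_add_sum (qcmAlg F) μ' hadd' K _ hmem h2).2,
        (qcm_add_sum (qcmAlg F) m hadd K _ hmem h2).2, Complex.re_sum]
      refine Finset.sum_congr rfl fun i _ => ?_
      obtain ⟨t, ht, hC⟩ := hcylt' s (B i)
      have e1 := hprop _ t ht (fun j => B i (t j)) (fun j => h1 i _)
      have e2 := hprop' _ t ht (fun j => B i (t j)) (fun j => h1 i _)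
      rw [hC] at e1
      have e3 := e2.symm.trans e1
      rw [hC] at e3
      exact_mod_cast e3
  · intro t₁ t₂ hne hs hf
    apply hs
    have key : ∀ a ∈ Λ t₁, ∀ b ∈ Λ t₂, a = b := by
      intro a ha b hb
      let ω : ∀ t, Λ t := fun t => if h1 : t = t₁ then ⟨a, h1 ▸ ha⟩ else
        if h2 : t = t₂ then ⟨b, h2 ▸ hb⟩ else ⟨(hΛ t).choose, (hΛ t).choose_spec⟩
      have := congrFun hf ω
      simpa [ω, hne.symm] using this
    obtain ⟨a, ha⟩ := hΛ t₁
    obtain ⟨b, hb⟩ := hΛ t₂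
    have hab := key a ha b hb
    subst hab
    refine ⟨a, ?_, ?_⟩
    · ext x
      exact ⟨fun hx => key x hx a hb, fun hx => by rw [Set.mem_singleton_iff.1 hx]; exact ha⟩
    · ext x
      exact ⟨fun hx => (key a ha x hx).symm, fun hx => by rw [Set.mem_singleton_iff.1 hx]; exact hb⟩
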